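/- Weighted lower bound: Let p be an odd prime, 0 < α ≤ 1/2, and 0 < ε ≤ 2^{-160}·p^{-8}. Then there exists n at least an exponential tower of p's of height (1/52)·log₂(2/ε) (i.e., n ≥ T(⌊(1/52)·log₂(2/ε)⌋) where T(1) = p, T(k+1) = p^{T(k)}) and a function f : 𝔽_p^n → [0,1] of density α such that for every nonzero d ∈ 𝔽_p^n, the density of 3-APs with common difference d of f is less than (1 − ε)·α³. -/

import Mathlib

/-- A tower of `p`'s of height `k`: `T 1 = p`, `T (k+1) = p ^ T k` (with `T 0 = 1`). -/
def towerP (p : ℕ) : ℕ → ℕ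
  | 0 => 1
  | k + 1 => p ^ towerP p k

open Finset

/-- the perturbation -/
noncomputable def gg (p : ℕ) [Fact p.Prime] (s : ZMod p) : ℝ :=
  -((ZMod.stdAddChar s).re + (ZMod.stdAddChar (2 * s)).re) / 2

/-- frequencies -/
def JJ (p : ℕ) : Fin 4 → ZMod p := ![1, -1, 2, -2]

lemma gg_complex (p : ℕ) [Fact p.Prime] (s : ZMod p) :
    ((gg p s : ℝ) : ℂ) = -(∑ i, (ZMod.stdAddChar (JJ p i * s) : ℂ)) / 4 := by
  have h : ∀ a : ZMod p, (ZMod.stdAddChar (-a) : ℂ) = starRingEnd ℂ (ZMod.stdAddChar a) := by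
    intro a
    rw [AddChar.map_neg_eq_conj]
  have h2 : ∀ z : ℂ, ((z.re : ℝ) : ℂ) = (z + starRingEnd ℂ z) / 2 := by
    intro z; rw [Complex.add_conj]; push_cast; ring
  simp only [gg, Fin.sum_univ_four, JJ, Matrix.cons_val, one_mul, neg_mul]
  push_cast
  rw [h2, h2, ← h, ← h]
  ring

lemma gg_bounds (p : ℕ) [Fact p.Prime] (s : ZMod p) : -1 ≤ gg p s ∧ gg p s ≤ 9/16 := by
  have hn : ‖(ZMod.stdAddChar s : ℂ)‖ = 1 := AddChar.norm_apply _ _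
  have h2 : (ZMod.stdAddChar (2 * s) : ℂ) = (ZMod.stdAddChar s) ^ 2 := by
    rw [two_mul, AddChar.map_add_eq_mul, sq]
  set z : ℂ := ZMod.stdAddChar s with hz
  have h3 : z.re * z.re + z.im * z.im = 1 := by
    rw [← Complex.normSq_apply, Complex.normSq_eq_norm_sq, hn]; norm_num
  have h4 : (z^2).re = z.re * z.re - z.im * z.im := by rw [sq, Complex.mul_re]
  have h5 : z.re ≤ 1 := by nlinarith [sq_nonneg z.im, sq_nonneg (z.re - 1)]
  have h6 : -1 ≤ z.re := by nlinarith [sq_nonneg z.im, sq_nonneg (z.re + 1)]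
  unfold gg
  rw [h2, h4, ← hz]
  constructor
  · nlinarith
  · nlinarith [sq_nonneg (4 * z.re + 1)]

lemma two_ne (p : ℕ) [Fact p.Prime] (hodd : Odd p) : (2 : ZMod p) ≠ 0 := by
  intro h
  have : ((2 : ℕ) : ZMod p) = 0 := by exact_mod_cast h
  rw [ZMod.natCast_eq_zero_iff] at this
  have h1 := (Nat.prime_dvd_prime_iff_eq Fact.out Nat.prime_two).1 this
  subst h1
  exact absurd hodd (by decide)

lemma char_sum (p : ℕ) [Fact p.Prime] (a : ZMod p) :
    ∑ s : ZMod p, (ZMod.stdAddChar (a * s) : ℂ) = if a = 0 then (p : ℂ) else 0 := by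
  have := AddChar.sum_mulShift (R := ZMod p) (R' := ℂ) (ψ := ZMod.stdAddChar) a
    (ZMod.isPrimitive_stdAddChar p)
  simp only [ZMod.card] at this
  simp only [mul_comm a]
  rw [this]
  split_ifs <;> simp

lemma gg_sum (p : ℕ) [Fact p.Prime] (hodd : Odd p) : ∑ s, gg p s = 0 := by
  have h2 := two_ne p hodd
  have : ((∑ s, gg p s : ℝ) : ℂ) = 0 := by
    push_cast
    simp only [gg_complex]
    rw [← Finset.sum_div, Finset.sum_neg_distrib, Finset.sum_comm]
    simp only [char_sum]
    simp [Fin.sum_univ_four, JJ, h2]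
  exact_mod_cast this

lemma gg_triple (p : ℕ) [Fact p.Prime] :
    ∑ s, ∑ t, gg p s * gg p (s + t) * gg p (s + 2 * t) ≤ - (p : ℝ) ^ 2 / 64 := by
  have key : ((∑ s, ∑ t, gg p s * gg p (s + t) * gg p (s + 2 * t) : ℝ) : ℂ)
      = ((-(∑ i, ∑ j, ∑ k, (if JJ p i + JJ p j + JJ p k = 0 ∧ JJ p j + JJ p k * 2 = 0
          then (p : ℝ)^2 else 0)) / 64 : ℝ) : ℂ) := by
    push_cast
    simp only [gg_complex]
    have e1 : ∀ s t : ZMod p, (-(∑ i, (ZMod.stdAddChar (JJ p i * s) : ℂ)) / 4) *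
        (-(∑ i, (ZMod.stdAddChar (JJ p i * (s + t)) : ℂ)) / 4) *
        (-(∑ i, (ZMod.stdAddChar (JJ p i * (s + 2 * t)) : ℂ)) / 4) =
        (-1/64) * ∑ i, ∑ j, ∑ k, (ZMod.stdAddChar ((JJ p i + JJ p j + JJ p k) * s) : ℂ) *
          (ZMod.stdAddChar ((JJ p j + JJ p k * 2) * t) : ℂ) := by
      intro s t
      have : ∀ i j k, (ZMod.stdAddChar ((JJ p i + JJ p j + JJ p k) * s) : ℂ) *
          (ZMod.stdAddChar ((JJ p j + JJ p k * 2) * t) : ℂ) =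
          (ZMod.stdAddChar (JJ p i * s) : ℂ) * (ZMod.stdAddChar (JJ p j * (s + t)) : ℂ) *
            (ZMod.stdAddChar (JJ p k * (s + 2 * t)) : ℂ) := by
        intro i j k
        simp only [← AddChar.map_add_eq_mul]
        congr 1; ring
      simp only [this]
      simp only [← Finset.mul_sum, ← Finset.sum_mul]
      ring
    simp only [e1, ← Finset.mul_sum]
    have e2 : ∑ s : ZMod p, ∑ t : ZMod p, ∑ i, ∑ j, ∑ k,
        (ZMod.stdAddChar ((JJ p i + JJ p j + JJ p k) * s) : ℂ) *
          (ZMod.stdAddChar ((JJ p j + JJ p k * 2) * t) : ℂ) =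
        ∑ i, ∑ j, ∑ k, ∑ s : ZMod p, ∑ t : ZMod p,
        (ZMod.stdAddChar ((JJ p i + JJ p j + JJ p k) * s) : ℂ) *
          (ZMod.stdAddChar ((JJ p j + JJ p k * 2) * t) : ℂ) := by
      simp only [Fin.sum_univ_four, Finset.sum_add_distrib]
    rw [e2]
    simp only [← Finset.mul_sum, ← Finset.sum_mul, char_sum]
    have e3 : ∀ i j k, ((if JJ p i + JJ p j + JJ p k = 0 then (p:ℂ) else 0) *
        if JJ p j + JJ p k * 2 = 0 then (p:ℂ) else 0) =
        if JJ p i + JJ p j + JJ p k = 0 ∧ JJ p j + JJ p k * 2 = 0 then (p:ℂ)^2 else 0 := by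
      intro i j k
      split_ifs <;> first | (exfalso; tauto) | simp [sq]
    have e4 : ∀ i j k, (((if JJ p i + JJ p j + JJ p k = 0 ∧ JJ p j + JJ p k * 2 = 0
        then (p:ℝ)^2 else 0 : ℝ)) : ℂ) =
        if JJ p i + JJ p j + JJ p k = 0 ∧ JJ p j + JJ p k * 2 = 0 then (p:ℂ)^2 else 0 := by
      intro i j k
      split_ifs <;> simp
    simp only [e3, e4]
    ring
  have key2 := Complex.ofReal_injective key
  rw [key2]
  have h0 : ∀ i j k, 0 ≤ (if JJ p i + JJ p j + JJ p k = 0 ∧ JJ p j + JJ p k * 2 = 0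
          then (p : ℝ)^2 else 0) := by
    intro i j k; split_ifs <;> positivity
  have h1 : (p:ℝ)^2 ≤ ∑ i, ∑ j, ∑ k, (if JJ p i + JJ p j + JJ p k = 0 ∧ JJ p j + JJ p k * 2 = 0
          then (p : ℝ)^2 else 0) := by
    calc (p:ℝ)^2 = (if JJ p 0 + JJ p 3 + JJ p 0 = 0 ∧ JJ p 3 + JJ p 0 * 2 = 0
          then (p : ℝ)^2 else 0) := by
            rw [if_pos]; simp only [JJ, Matrix.cons_val]; constructor <;> ring
      _ ≤ ∑ k, (if JJ p 0 + JJ p 3 + JJ p k = 0 ∧ JJ p 3 + JJ p k * 2 = 0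
          then (p : ℝ)^2 else 0) :=
            Finset.single_le_sum (f := fun k => (if JJ p 0 + JJ p 3 + JJ p k = 0 ∧ JJ p 3 + JJ p k * 2 = 0
          then (p : ℝ)^2 else 0)) (fun k _ => h0 0 3 k) (Finset.mem_univ 0)
      _ ≤ ∑ j, ∑ k, (if JJ p 0 + JJ p j + JJ p k = 0 ∧ JJ p j + JJ p k * 2 = 0
          then (p : ℝ)^2 else 0) :=
            Finset.single_le_sum (f := fun j => ∑ k, (if JJ p 0 + JJ p j + JJ p k = 0 ∧ JJ p j + JJ p k * 2 = 0
          then (p : ℝ)^2 else 0)) (fun j _ => Finset.sum_nonneg fun k _ => h0 0 j k) (Finset.mem_univ 3)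
      _ ≤ _ :=
            Finset.single_le_sum (f := fun i => ∑ j, ∑ k, (if JJ p i + JJ p j + JJ p k = 0 ∧ JJ p j + JJ p k * 2 = 0
          then (p : ℝ)^2 else 0)) (fun i _ => Finset.sum_nonneg fun j _ => Finset.sum_nonneg fun k _ => h0 i j k) (Finset.mem_univ 0)
  linarith

/-- average over one line minus one -/
noncomputable def DD (p : ℕ) [Fact p.Prime] (t : ZMod p) : ℝ :=
  (∑ s, (1 + gg p s) * (1 + gg p (s + t)) * (1 + gg p (s + 2 * t))) / p - 1

lemma DD_bounds (p : ℕ) [Fact p.Prime] (t : ZMod p) : -1 ≤ DD p t ∧ DD p t ≤ 3 := by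
  have hp : (0:ℝ) < p := by exact_mod_cast (Fact.out : p.Prime).pos
  have h0 : ∀ s, 0 ≤ (1 + gg p s) * (1 + gg p (s + t)) * (1 + gg p (s + 2 * t)) := by
    intro s
    have h1 := (gg_bounds p s).1
    have h2 := (gg_bounds p (s+t)).1
    have h3 := (gg_bounds p (s+2*t)).1
    have h1 : 0 ≤ 1 + gg p s := by linarith
    have h2 : 0 ≤ 1 + gg p (s+t) := by linarith
    have h3 : 0 ≤ 1 + gg p (s+2*t) := by linarith
    positivity
  have h4 : ∀ s, (1 + gg p s) * (1 + gg p (s + t)) * (1 + gg p (s + 2 * t)) ≤ 4 := by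
    intro s
    have h1 := (gg_bounds p s)
    have h2 := (gg_bounds p (s+t))
    have h3 := (gg_bounds p (s+2*t))
    calc _ ≤ (25/16:ℝ) * (25/16) * (25/16) := by
          gcongr <;> linarith
      _ ≤ 4 := by norm_num
  unfold DD
  constructor
  · have : 0 ≤ (∑ s, (1 + gg p s) * (1 + gg p (s + t)) * (1 + gg p (s + 2 * t))) / p :=
      div_nonneg (Finset.sum_nonneg fun s _ => h0 s) hp.le
    linarith
  · have : (∑ s, (1 + gg p s) * (1 + gg p (s + t)) * (1 + gg p (s + 2 * t))) / p ≤ 4 := by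
      rw [div_le_iff₀ hp]
      calc _ ≤ ∑ s : ZMod p, (4:ℝ) := Finset.sum_le_sum fun s _ => h4 s
        _ = 4 * p := by simp [ZMod.card]; ring
    linarith

lemma DD_sum (p : ℕ) [Fact p.Prime] (hodd : Odd p) : ∑ t, DD p t ≤ - (p:ℝ) / 64 := by
  have hp : (0:ℝ) < p := by exact_mod_cast (Fact.out : p.Prime).pos
  have h2 := two_ne p hodd
  have g0 := gg_sum p hodd
  have s1 : ∀ s : ZMod p, ∑ t, gg p (s + t) = 0 := by
    intro s; rw [← g0]; exact Fintype.sum_equiv (Equiv.addLeft s) _ _ (fun t => rfl)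
  have s2 : ∀ s : ZMod p, ∑ t, gg p (s + 2 * t) = 0 := by
    intro s; rw [← g0]
    exact Fintype.sum_equiv ((Equiv.mulLeft₀ 2 h2).trans (Equiv.addLeft s)) _ _ (fun t => rfl)
  have s3 : ∑ s : ZMod p, ∑ t, gg p (s + t) * gg p (s + 2 * t) = 0 := by
    have : ∀ s : ZMod p, ∑ t, gg p (s + t) * gg p (s + 2 * t) = ∑ u, gg p u * gg p (2 * u - s) := by
      intro s
      refine Fintype.sum_equiv (Equiv.addLeft s) _ _ (fun t => ?_)
      simp only [Equiv.coe_addLeft]; congr 2; ring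
    simp only [this]
    rw [Finset.sum_comm]
    apply Finset.sum_eq_zero
    intro u _
    rw [← Finset.mul_sum]
    have : ∑ s, gg p (2 * u - s) = 0 := by
      rw [← g0]; exact Fintype.sum_equiv (Equiv.subLeft (2*u)) _ _ (fun t => rfl)
    rw [this, mul_zero]
  have e : ∑ t, DD p t = (∑ s, ∑ t, gg p s * gg p (s + t) * gg p (s + 2 * t)) / p := by
    unfold DD
    rw [Finset.sum_sub_distrib, ← Finset.sum_div, Finset.sum_comm]
    have : ∀ s : ZMod p, ∑ t, (1 + gg p s) * (1 + gg p (s + t)) * (1 + gg p (s + 2 * t)) =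
        p * (1 + gg p s) + ∑ t, gg p (s + t) * gg p (s + 2 * t) +
          ∑ t, gg p s * gg p (s + t) * gg p (s + 2 * t) := by
      intro s
      have : ∀ t, (1 + gg p s) * (1 + gg p (s + t)) * (1 + gg p (s + 2 * t)) =
        (1 + gg p s) + (1 + gg p s) * gg p (s + t) + (1 + gg p s) * gg p (s + 2 * t) +
          gg p (s + t) * gg p (s + 2 * t) + gg p s * gg p (s + t) * gg p (s + 2 * t) := by
        intro t; ring
      simp only [this, Finset.sum_add_distrib, ← Finset.mul_sum, s1, s2]
      simp [ZMod.card]; ring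
    simp only [this, Finset.sum_add_distrib, s3, ← Finset.mul_sum, g0]
    simp [ZMod.card]
    field_simp; ring
  rw [e, div_le_iff₀ hp]
  have := gg_triple p
  nlinarith
open Finset Matrix in
lemma shift_sum (p : ℕ) [Fact p.Prime] {K : ℕ} (v w : Fin K → ZMod p) (hw : v ⬝ᵥ w = 1)
    (F : ZMod p → ℝ) (H : (Fin K → ZMod p) → ℝ) (hH : ∀ (s : ZMod p) y, H (y + s • w) = H y) :
    (p:ℝ) * ∑ y, F (v ⬝ᵥ y) * H y = (∑ s, F s) * ∑ y, H y := by
  have h1 : ∀ s : ZMod p, ∑ y, F (v ⬝ᵥ y) * H y = ∑ y, F (v ⬝ᵥ y + s) * H y := by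
    intro s
    rw [← Equiv.sum_comp (Equiv.addRight (s • w))]
    apply Finset.sum_congr rfl
    intro y _
    simp only [Equiv.coe_addRight, hH, dotProduct_add, dotProduct_smul, hw, smul_eq_mul, mul_one]
  have h2 : ∑ s : ZMod p, ∑ y, F (v ⬝ᵥ y) * H y = (p:ℝ) * ∑ y, F (v ⬝ᵥ y) * H y := by
    simp [ZMod.card]
  rw [← h2, Finset.sum_congr rfl (fun s _ => h1 s), Finset.sum_comm, Finset.mul_sum]
  apply Finset.sum_congr rfl
  intro y _
  rw [← Finset.sum_mul]
  congr 1
  exact Fintype.sum_equiv (Equiv.addLeft (v ⬝ᵥ y)) _ _ (fun t => rfl)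

open Matrix in
lemma exists_dual_one (p : ℕ) [Fact p.Prime] {K : ℕ} (v : Fin K → ZMod p) (hv : v ≠ 0) :
    ∃ w, v ⬝ᵥ w = 1 := by
  obtain ⟨i, hi⟩ := Function.ne_iff.1 hv
  refine ⟨Pi.single i (v i)⁻¹, ?_⟩
  rw [dotProduct_single]
  exact mul_inv_cancel₀ hi

open Matrix in
lemma exists_dual (p : ℕ) [Fact p.Prime] {K : ℕ} (v a b : Fin K → ZMod p)
    (h : ∀ s t : ZMod p, v ≠ s • a + t • b) :
    ∃ w, v ⬝ᵥ w = 1 ∧ a ⬝ᵥ w = 0 ∧ b ⬝ᵥ w = 0 := by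
  have hn : v ∉ Submodule.span (ZMod p) {a, b} := by
    intro hm
    obtain ⟨s, t, hst⟩ := Submodule.mem_span_pair.1 hm
    exact h s t hst.symm
  obtain ⟨f, hf, hk⟩ := Submodule.exists_le_ker_of_notMem hn
  have ha : f a = 0 := hk (Submodule.subset_span (by simp))
  have hb : f b = 0 := hk (Submodule.subset_span (by simp))
  have hf' : ∀ u, f u = u ⬝ᵥ (fun i => f (Pi.single i 1)) := by
    intro u
    conv_lhs => rw [← Finset.univ_sum_single u]
    rw [map_sum, dotProduct]
    apply Finset.sum_congr rfl
    intro i _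
    have : (Pi.single i (u i) : Fin K → ZMod p) = u i • Pi.single i 1 := by
      rw [← Pi.single_smul]; simp
    rw [this, map_smul, smul_eq_mul]
  refine ⟨(f v)⁻¹ • (fun i => f (Pi.single i 1)), ?_, ?_, ?_⟩
  · rw [dotProduct_smul, ← hf', smul_eq_mul, inv_mul_cancel₀ hf]
  · rw [dotProduct_smul, ← hf', ha, smul_zero]
  · rw [dotProduct_smul, ← hf', hb, smul_zero]

open Matrix in
lemma exp_count (p : ℕ) [Fact p.Prime] (hodd : Odd p) {K : ℕ} {ι : Type} [Fintype ι] [DecidableEq ι]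
    (y : Fin K → ZMod p) (hy : y ≠ 0) :
    ∑ v : ι → Fin K → ZMod p,
      Real.exp ((1/2304) * (∑ i, DD p (v i ⬝ᵥ y) + (Fintype.card ι : ℝ) / 128)) ≤
    ((p:ℝ)^K)^(Fintype.card ι) * Real.exp (-(Fintype.card ι : ℝ) / 589824) := by
  have hp : (0:ℝ) < p := by exact_mod_cast (Fact.out : p.Prime).pos
  have h1 : ∀ v : ι → Fin K → ZMod p,
      Real.exp ((1/2304) * (∑ i, DD p (v i ⬝ᵥ y) + (Fintype.card ι : ℝ) / 128)) =
      ∏ i, Real.exp ((1/2304) * (DD p (v i ⬝ᵥ y) + 1/128)) := by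
    intro v
    rw [← Real.exp_sum, ← Finset.mul_sum, Finset.sum_add_distrib]
    congr 3
    simp; ring
  simp only [h1]
  have h2 : ∑ v : ι → Fin K → ZMod p, ∏ i, Real.exp ((1/2304) * (DD p (v i ⬝ᵥ y) + 1/128)) =
      ∏ i : ι, ∑ w : Fin K → ZMod p, Real.exp ((1/2304) * (DD p (w ⬝ᵥ y) + 1/128)) := by
    rw [Finset.prod_univ_sum]; simp
  rw [h2, Finset.prod_const, Finset.card_univ]
  have h3 : ∑ w : Fin K → ZMod p, Real.exp ((1/2304) * (DD p (w ⬝ᵥ y) + 1/128)) ≤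
      (p:ℝ)^K * Real.exp (-1/589824) := by
    obtain ⟨w0, hw0⟩ := exists_dual_one p y hy
    have := shift_sum p y w0 hw0 (fun t => Real.exp ((1/2304) * (DD p t + 1/128))) (fun _ => 1)
      (by simp)
    simp only [mul_one, Finset.sum_const, Finset.card_univ, Fintype.card_pi, ZMod.card,
      Finset.prod_const, Fintype.card_fin, nsmul_eq_mul] at this
    simp only [dotProduct_comm _ y]
    have hb : ∑ t, Real.exp ((1/2304) * (DD p t + 1/128)) ≤ p * Real.exp (-1/589824) := by
      have hx : ∀ t, Real.exp ((1/2304) * DD p t) ≤ 1 + (1/2304) * DD p t + 9 / 2304^2 := by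
        intro t
        have hD := DD_bounds p t
        have habs : |(1/2304) * DD p t| ≤ 1 := by
          rw [abs_le]; constructor <;> linarith [hD.1, hD.2]
        have := (abs_le.1 (Real.abs_exp_sub_one_sub_id_le habs)).2
        nlinarith [hD.1, hD.2]
      have hs : ∑ t, Real.exp ((1/2304) * DD p t) ≤ p * Real.exp (-1/147456 + 9/2304^2) := by
        calc _ ≤ ∑ t, (1 + (1/2304) * DD p t + 9 / 2304^2) := Finset.sum_le_sum fun t _ => hx t
          _ = p * (1 + 9/2304^2) + (1/2304) * ∑ t, DD p t := by
            simp only [Finset.sum_add_distrib, ← Finset.mul_sum]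
            simp [ZMod.card]; ring
          _ ≤ p * ((-1/147456 + 9/2304^2) + 1) := by
            have := DD_sum p hodd
            nlinarith
          _ ≤ _ := by
            gcongr
            exact Real.add_one_le_exp _
      have : ∀ t, Real.exp ((1/2304) * (DD p t + 1/128)) =
          Real.exp ((1/2304) * DD p t) * Real.exp (1/294912) := by
        intro t; rw [← Real.exp_add]; congr 1; ring
      simp only [this]
      rw [← Finset.sum_mul]
      calc _ ≤ (p * Real.exp (-1/147456 + 9/2304^2)) * Real.exp (1/294912) := by gcongr
        _ = _ := by
          rw [mul_assoc, ← Real.exp_add]; congr 2; norm_num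
    refine le_of_mul_le_mul_left ?_ hp
    rw [this]
    push_cast
    calc _ ≤ (p * Real.exp (-1/589824)) * (p:ℝ)^K := by gcongr
      _ = _ := by ring
  calc _ ≤ ((p:ℝ)^K * Real.exp (-1/589824))^(Fintype.card ι) := by
        gcongr
    _ = _ := by
      rw [mul_pow, ← Real.exp_nat_mul]; congr 2; ring

lemma dep_count (p : ℕ) [Fact p.Prime] {K : ℕ} {ι : Type} [Fintype ι] [DecidableEq ι]
    (i j k : ι) (hj : j ≠ i) (hk : k ≠ i) (s t : ZMod p) :
    (p:ℝ)^K * ∑ v : ι → Fin K → ZMod p, (if v i = s • v j + t • v k then (1:ℝ) else 0) =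
      ((p:ℝ)^K)^(Fintype.card ι) := by
  have h1 : ∀ w : Fin K → ZMod p,
      ∑ v : ι → Fin K → ZMod p, (if v i = s • v j + t • v k then (1:ℝ) else 0) =
      ∑ v : ι → Fin K → ZMod p, (if w = s • v j + t • v k - v i then (1:ℝ) else 0) := by
    intro w
    rw [← Equiv.sum_comp (Equiv.addRight (Pi.single i w : ι → Fin K → ZMod p))]
    apply Finset.sum_congr rfl
    intro v _
    simp only [Equiv.coe_addRight, Pi.add_apply, Pi.single_eq_same, Pi.single_eq_of_ne hj,
      Pi.single_eq_of_ne hk, add_zero]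
    congr 1
    rw [eq_sub_iff_add_eq, add_comm]
  have h2 : (p:ℝ)^K * ∑ v : ι → Fin K → ZMod p, (if v i = s • v j + t • v k then (1:ℝ) else 0) =
      ∑ w : Fin K → ZMod p, ∑ v : ι → Fin K → ZMod p,
        (if v i = s • v j + t • v k then (1:ℝ) else 0) := by
    simp [ZMod.card]
  rw [h2, Finset.sum_congr rfl (fun w _ => h1 w), Finset.sum_comm]
  simp [ZMod.card]

open Matrix in
lemma exists_v (p : ℕ) [Fact p.Prime] (hodd : Odd p) {K : ℕ} {ι : Type} [Fintype ι] [DecidableEq ι]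
    (h1 : (p:ℝ)^K * Real.exp (-(Fintype.card ι : ℝ) / 589824) ≤ 1/4)
    (h2 : (Fintype.card ι : ℝ)^3 * (p:ℝ)^2 ≤ 1/4 * (p:ℝ)^K) :
    ∃ v : ι → Fin K → ZMod p,
      (∀ y, y ≠ 0 → ∑ i, DD p (v i ⬝ᵥ y) ≤ - (Fintype.card ι : ℝ) / 128) ∧
      (∀ i j k, j ≠ i → k ≠ i → ∀ s t : ZMod p, v i ≠ s • v j + t • v k) := by
  have hp : (0:ℝ) < p := by exact_mod_cast (Fact.out : p.Prime).pos
  set T : ℝ := ((p:ℝ)^K)^(Fintype.card ι) with hT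
  have hTpos : 0 < T := by positivity
  let E1 : (ι → Fin K → ZMod p) → (Fin K → ZMod p) → ℝ := fun v y =>
    if y = 0 then 0 else Real.exp ((1/2304) * (∑ i, DD p (v i ⬝ᵥ y) + (Fintype.card ι : ℝ) / 128))
  let E2 : (ι → Fin K → ZMod p) → (ι × ι × ι × ZMod p × ZMod p) → ℝ := fun v q =>
    if q.2.1 ≠ q.1 ∧ q.2.2.1 ≠ q.1 then
      (if v q.1 = q.2.2.2.1 • v q.2.1 + q.2.2.2.2 • v q.2.2.1 then (1:ℝ) else 0) else 0
  have E1nn : ∀ v y, 0 ≤ E1 v y := by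
    intro v y; simp only [E1]; split_ifs <;> positivity
  have E2nn : ∀ v q, 0 ≤ E2 v q := by
    intro v q; simp only [E2]; split_ifs <;> positivity
  have S1 : ∑ v, ∑ y, E1 v y ≤ T * (1/4) := by
    rw [Finset.sum_comm]
    calc _ ≤ ∑ y : Fin K → ZMod p, T * Real.exp (-(Fintype.card ι : ℝ) / 589824) := by
          apply Finset.sum_le_sum
          intro y _
          by_cases hy : y = 0
          · simp only [E1, hy, if_true]; simp; positivity
          · simp only [E1, hy, if_false]
            exact exp_count p hodd y hy
      _ = T * ((p:ℝ)^K * Real.exp (-(Fintype.card ι : ℝ) / 589824)) := by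
          simp [ZMod.card]; ring
      _ ≤ _ := by gcongr
  have S2 : ∑ v, ∑ q, E2 v q ≤ T * (1/4) := by
    rw [Finset.sum_comm]
    calc _ ≤ ∑ q : ι × ι × ι × ZMod p × ZMod p, T / (p:ℝ)^K := by
          apply Finset.sum_le_sum
          rintro ⟨i, j, k, s, t⟩ _
          by_cases hq : j ≠ i ∧ k ≠ i
          · simp only [E2, if_pos hq]
            rw [le_div_iff₀ (by positivity), mul_comm]
            simpa using (dep_count p (K := K) i j k hq.1 hq.2 s t).le
          · simp only [E2, hq, if_false]; simp; positivity
      _ = T * ((Fintype.card ι : ℝ)^3 * (p:ℝ)^2) / (p:ℝ)^K := by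
          simp [ZMod.card]; ring
      _ ≤ _ := by
          rw [div_le_iff₀ (by positivity), mul_assoc]
          gcongr
  have hlt : ∑ v, (∑ y, E1 v y + ∑ q, E2 v q) < ∑ v : ι → Fin K → ZMod p, (1:ℝ) := by
    rw [Finset.sum_add_distrib]
    have : ∑ v : ι → Fin K → ZMod p, (1:ℝ) = T := by
      simp [ZMod.card, hT]
    rw [this]; linarith
  obtain ⟨v, -, hv⟩ := Finset.exists_lt_of_sum_lt hlt
  have p1 : 0 ≤ ∑ y, E1 v y := Finset.sum_nonneg fun y _ => E1nn v y
  have p2 : 0 ≤ ∑ q, E2 v q := Finset.sum_nonneg fun y _ => E2nn v y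
  refine ⟨v, ?_, ?_⟩
  · intro y hy
    have := Finset.single_le_sum (f := E1 v) (fun y _ => E1nn v y) (Finset.mem_univ y)
    have h3 : E1 v y < 1 := by linarith
    simp only [E1, hy, if_false] at h3
    rw [Real.exp_lt_one_iff] at h3
    linarith
  · intro i j k hj hk s t heq
    have := Finset.single_le_sum (f := E2 v) (fun y _ => E2nn v y) (Finset.mem_univ (i,j,k,s,t))
    have h3 : E2 v (i,j,k,s,t) < 1 := by linarith
    simp only [E2, hj, hk, ne_eq, not_false_eq_true, and_self, if_true, ← heq] at h3
    linarith

/-- the inductive invariant -/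
structure Good (V : Type) [AddCommGroup V] [Fintype V] (N B : ℝ) (φ : V → ℝ) : Prop where
  nonneg : ∀ x, 0 ≤ φ x
  le : ∀ x, φ x ≤ 25/16
  mean : ∑ x, φ x = (Fintype.card V : ℝ) * (1 - 1/N)
  ap : ∀ d, d ≠ 0 → ∑ x, φ x * φ (x + d) * φ (x + 2 • d) ≤ (Fintype.card V : ℝ) * (1 - 3/N)
  cube : ∑ x, φ x * φ x * φ x ≤ (Fintype.card V : ℝ) * (1 - 3/N) + 3 * B
  bad : (Nat.card {x // φ x ≠ 1} : ℝ) ≤ B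

lemma Good.transport {V V' : Type} [AddCommGroup V] [Fintype V] [AddCommGroup V'] [Fintype V']
    {N B : ℝ} {φ : V → ℝ} (h : Good V N B φ) (e : V' ≃+ V) : Good V' N B (φ ∘ e) := by
  have hc : Fintype.card V' = Fintype.card V := Fintype.card_congr e.toEquiv
  refine ⟨fun x => h.nonneg _, fun x => h.le _, ?_, ?_, ?_, ?_⟩
  · rw [hc, ← h.mean]
    exact Fintype.sum_equiv e.toEquiv _ _ (fun t => rfl)
  · intro d hd
    rw [hc]
    refine le_trans (le_of_eq ?_) (h.ap (e d) (by simpa using hd))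
    refine Fintype.sum_equiv e.toEquiv _ _ (fun t => ?_)
    simp
  · rw [hc]
    refine le_trans (le_of_eq ?_) h.cube
    exact Fintype.sum_equiv e.toEquiv _ _ (fun t => rfl)
  · refine le_trans (le_of_eq ?_) h.bad
    congr 1
    exact Nat.card_congr (e.toEquiv.subtypeEquiv (fun a => Iff.rfl))

open Matrix Classical in
lemma Good.step (p : ℕ) [Fact p.Prime] (hodd : Odd p) {V : Type} [AddCommGroup V] [Fintype V]
    (htwo : ∀ d : V, 2 • d = 0 → d = 0)
    {N B : ℝ} {φ : V → ℝ} (h : Good V N B φ) (K M : ℕ) (hM2 : 2 ≤ M)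
    (h1 : (p:ℝ)^K * Real.exp (-(M : ℝ) / 589824) ≤ 1/4)
    (h2 : (M : ℝ)^3 * (p:ℝ)^2 ≤ 1/4 * (p:ℝ)^K)
    (h3 : 384 * B ≤ M) (h4 : M + B ≤ Fintype.card V) :
    ∃ Φ : V × (Fin K → ZMod p) → ℝ, Good (V × (Fin K → ZMod p)) N ((B + M) * (p:ℝ)^K) Φ := by
  have hp : (0:ℝ) < p := by exact_mod_cast (Fact.out : p.Prime).pos
  -- the set X
  obtain ⟨X, hX1, hXM⟩ : ∃ X : Finset V, (∀ x ∈ X, φ x = 1) ∧ X.card = M := by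
    have hc : M ≤ (Finset.univ.filter (fun x => φ x = 1)).card := by
      have e := Finset.card_filter_add_card_filter_not (s := (Finset.univ : Finset V)) (fun x => φ x = 1)
      have hb := h.bad
      rw [Nat.card_eq_fintype_card, Fintype.card_subtype] at hb
      rw [Finset.card_univ] at e
      have e' : ((Finset.univ.filter (fun x => φ x = 1)).card : ℝ) +
        (Finset.univ.filter (fun x => ¬ φ x = 1)).card = Fintype.card V := by exact_mod_cast e
      have : (M:ℝ) ≤ (Finset.univ.filter (fun x => φ x = 1)).card := by
        simp only [ne_eq] at hb
        linarith
      exact_mod_cast this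
    obtain ⟨X, hX, hXc⟩ := Finset.exists_subset_card_eq hc
    exact ⟨X, fun x hx => (Finset.mem_filter.1 (hX hx)).2, hXc⟩
  have hcard : Fintype.card X = M := by rw [Fintype.card_coe, hXM]
  obtain ⟨v0, hv1, hv2⟩ := exists_v p hodd (K := K) (ι := X) (by rw [hcard]; exact h1)
    (by rw [hcard]; exact h2)
  rw [hcard] at hv1
  -- extended
  let v : V → Fin K → ZMod p := fun x => if hx : x ∈ X then v0 ⟨x, hx⟩ else 0
  have hvX : ∀ x (hx : x ∈ X), v x = v0 ⟨x, hx⟩ := fun x hx => by simp only [v, hx, dif_pos]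
  have hvD : ∀ y, y ≠ 0 → ∑ x ∈ X, DD p (v x ⬝ᵥ y) ≤ -(M:ℝ)/128 := by
    intro y hy
    refine le_trans (le_of_eq ?_) (hv1 y hy)
    rw [← Finset.sum_coe_sort X]
    apply Finset.sum_congr rfl
    rintro ⟨x, hx⟩ _
    rw [hvX x hx]
  have hvI : ∀ x ∈ X, ∀ x' x'', x' ≠ x → x'' ≠ x →
      ∃ w, v x ⬝ᵥ w = 1 ∧ v x' ⬝ᵥ w = 0 ∧ v x'' ⬝ᵥ w = 0 := by
    intro x hx x' x'' hx' hx''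
    apply exists_dual
    intro s t heq
    obtain ⟨j0, hj0, hj0x⟩ : ∃ j ∈ X, j ≠ x := by
      apply Finset.exists_mem_ne; omega
    have aux : ∀ u, u ≠ x → ∀ s : ZMod p, ∃ j : X, j ≠ ⟨x, hx⟩ ∧ ∃ s' : ZMod p, s • v u = s' • v0 j := by
      intro u hu s
      by_cases hm : u ∈ X
      · exact ⟨⟨u, hm⟩, by simpa using hu, s, by rw [hvX u hm]⟩
      · exact ⟨⟨j0, hj0⟩, by simpa using hj0x, 0, by simp [v, hm]⟩
    obtain ⟨j, hj, s', e1⟩ := aux x' hx' s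
    obtain ⟨k, hk, t', e2⟩ := aux x'' hx'' t
    apply hv2 ⟨x, hx⟩ j k hj hk s' t'
    rw [← hvX x hx, heq, e1, e2]
  have hv0 : ∀ x ∈ X, ∃ w, v x ⬝ᵥ w = 1 := by
    intro x hx
    obtain ⟨j0, hj0, hj0x⟩ : ∃ j ∈ X, j ≠ x := by
      apply Finset.exists_mem_ne; omega
    obtain ⟨w, hw, -⟩ := hvI x hx j0 j0 hj0x hj0x
    exact ⟨w, hw⟩
  have g0 := gg_sum p hodd
  -- new function
  let Γ : V → (Fin K → ZMod p) → ℝ := fun x y => if x ∈ X then gg p (v x ⬝ᵥ y) else 0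
  let F : V → (Fin K → ZMod p) → ℝ := fun x y => φ x + Γ x y
  have cW : ∑ y : Fin K → ZMod p, (1:ℝ) = (p:ℝ)^K := by simp [ZMod.card]
  have cV : ((Fintype.card (V × (Fin K → ZMod p)) : ℕ) : ℝ) = Fintype.card V * (p:ℝ)^K := by
    simp [ZMod.card]
  have hΓ0 : ∀ x (a : Fin K → ZMod p) (H : (Fin K → ZMod p) → ℝ),
      (x ∈ X → ∃ w, v x ⬝ᵥ w = 1 ∧ ∀ (s : ZMod p) y, H (y + s • w) = H y) →
      ∑ y, Γ x (y + a) * H y = 0 := by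
    intro x a H hH
    by_cases hx : x ∈ X
    · obtain ⟨w, hw, hH⟩ := hH hx
      have := shift_sum p (v x) w hw (fun s => gg p (s + v x ⬝ᵥ a)) H hH
      have e : ∑ s, gg p (s + v x ⬝ᵥ a) = 0 := by
        rw [← g0]; exact Fintype.sum_equiv (Equiv.addRight (v x ⬝ᵥ a)) _ _ (fun t => rfl)
      rw [e, zero_mul] at this
      simp only [Γ, hx, if_true, dotProduct_add]
      exact (mul_eq_zero.1 this).resolve_left hp.ne'
    · simp [Γ, hx]
  have hFinv : ∀ x w (s : ZMod p) (a y : Fin K → ZMod p), v x ⬝ᵥ w = 0 →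
      F x (y + s • w + a) = F x (y + a) := by
    intro x w s a y hw
    simp only [F, Γ, dotProduct_add, dotProduct_smul, hw, smul_zero, add_zero]
  -- line sums
  have hline : ∀ x (d : Fin K → ZMod p), ∑ y, F x y * F x (y + d) * F x (y + 2 • d) =
      (p:ℝ)^K * (φ x * φ x * φ x + if x ∈ X then DD p (v x ⬝ᵥ d) else 0) := by
    intro x d
    by_cases hx : x ∈ X
    · obtain ⟨w, hw⟩ := hv0 x hx
      have := shift_sum p (v x) w hw (fun s => (1 + gg p s) * (1 + gg p (s + v x ⬝ᵥ d)) *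
        (1 + gg p (s + 2 * v x ⬝ᵥ d))) (fun _ => 1) (by simp)
      simp only [mul_one, cW] at this
      simp only [F, Γ, hx, if_true, hX1 x hx, dotProduct_add, dotProduct_smul, DD]
      have e : ∀ t : ZMod p, 2 • t = 2 * t := fun t => by simp
      simp only [e]
      have h5 : ∀ a b : ℝ, (p:ℝ) * a = b * (p:ℝ)^K → a = (p:ℝ)^K * (1 * 1 * 1 + (b / p - 1)) := by
        intro a b hab
        field_simp
        linarith
      exact h5 _ _ this
    · simp only [F, Γ, hx, if_false, add_zero]
      rw [← mul_one (φ x * φ x * φ x), Finset.sum_const, Finset.card_univ]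
      simp [ZMod.card]
  have hlineV : ∀ (d : Fin K → ZMod p), ∑ x, ∑ y, F x y * F x (y + d) * F x (y + 2 • d) =
      (p:ℝ)^K * (∑ x, φ x * φ x * φ x + ∑ x ∈ X, DD p (v x ⬝ᵥ d)) := by
    intro d
    simp only [hline]
    rw [← Finset.mul_sum, Finset.sum_add_distrib]
    congr 2
    simp
  refine ⟨fun z => F z.1 z.2, ?_, ?_, ?_, ?_, ?_, ?_⟩
  · rintro ⟨x, y⟩
    simp only [F, Γ]
    split_ifs with hx
    · rw [hX1 x hx]; linarith [(gg_bounds p (v x ⬝ᵥ y)).1]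
    · simpa using h.nonneg x
  · rintro ⟨x, y⟩
    simp only [F, Γ]
    split_ifs with hx
    · rw [hX1 x hx]; linarith [(gg_bounds p (v x ⬝ᵥ y)).2]
    · simpa using h.le x
  · rw [cV, Fintype.sum_prod_type]
    have : ∀ x, ∑ y, F x y = φ x * (p:ℝ)^K := by
      intro x
      have := hΓ0 x 0 (fun _ => 1) (fun hx => by
        obtain ⟨w, hw⟩ := hv0 x hx
        exact ⟨w, hw, by simp⟩)
      simp only [add_zero, mul_one] at this
      simp only [F]
      rw [Finset.sum_add_distrib, this, ← cW, Finset.mul_sum]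
      simp
    simp only [this]
    rw [← Finset.sum_mul, h.mean]; ring
  · rintro ⟨d1, d2⟩ hd
    rw [cV, Fintype.sum_prod_type]
    simp only [Prod.fst_add, Prod.snd_add, Prod.smul_fst, Prod.smul_snd]
    by_cases hd1 : d1 = 0
    · subst hd1
      have hd2 : d2 ≠ 0 := by
        rintro rfl; exact hd rfl
      simp only [smul_zero, add_zero]
      rw [hlineV]
      have := hvD d2 hd2
      have hc := h.cube
      calc _ ≤ (p:ℝ)^K * ((Fintype.card V : ℝ) * (1 - 3/N)) := by
            gcongr; linarith
        _ = _ := by ring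
    · have hd12 : 2 • d1 ≠ 0 := fun hh => hd1 (htwo d1 hh)
      have key : ∀ x, ∑ y, F x y * F (x + d1) (y + d2) * F (x + 2 • d1) (y + 2 • d2) =
          (p:ℝ)^K * (φ x * φ (x + d1) * φ (x + 2 • d1)) := by
        intro x
        have n1 : x + d1 ≠ x := by simpa using hd1
        have n2 : x + 2 • d1 ≠ x := by simpa using hd12
        have n3 : x + 2 • d1 ≠ x + d1 := by
          rw [two_nsmul, ← add_assoc]; simpa using hd1
        have s1 := hΓ0 x 0 (fun y => F (x + d1) (y + d2) * F (x + 2 • d1) (y + 2 • d2)) (fun hx => by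
          obtain ⟨w, hw, ha, hb⟩ := hvI x hx _ _ n1 n2
          exact ⟨w, hw, fun s y => by rw [hFinv _ _ _ _ _ ha, hFinv _ _ _ _ _ hb]⟩)
        have s2 := hΓ0 (x + d1) d2 (fun y => F (x + 2 • d1) (y + 2 • d2)) (fun hx => by
          obtain ⟨w, hw, ha, hb⟩ := hvI _ hx _ _ n3 n3
          exact ⟨w, hw, fun s y => by rw [hFinv _ _ _ _ _ ha]⟩)
        have s3 := hΓ0 (x + 2 • d1) (2 • d2) (fun _ => 1) (fun hx => by
          obtain ⟨w, hw⟩ := hv0 _ hx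
          exact ⟨w, hw, by simp⟩)
        simp only [add_zero, mul_one] at s1 s3
        have t1 : ∀ y, F x y * F (x + d1) (y + d2) * F (x + 2 • d1) (y + 2 • d2) =
            Γ x y * (F (x + d1) (y + d2) * F (x + 2 • d1) (y + 2 • d2)) +
            φ x * (Γ (x + d1) (y + d2) * F (x + 2 • d1) (y + 2 • d2)) +
            φ x * φ (x + d1) * Γ (x + 2 • d1) (y + 2 • d2) +
            φ x * φ (x + d1) * φ (x + 2 • d1) * 1 := by
          intro y; simp only [F]; ring
        simp only [t1, Finset.sum_add_distrib]
        rw [s1, ← Finset.mul_sum, s2, ← Finset.mul_sum, s3, ← Finset.mul_sum, cW]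
        ring
      simp only [key]
      rw [← Finset.mul_sum]
      have := h.ap d1 hd1
      calc _ ≤ (p:ℝ)^K * ((Fintype.card V : ℝ) * (1 - 3/N)) := by gcongr
        _ = _ := by ring
  · rw [cV, Fintype.sum_prod_type]
    have e := hlineV 0
    simp only [smul_zero, add_zero] at e
    simp only
    rw [e]
    have hD : ∑ x ∈ X, DD p (v x ⬝ᵥ (0 : Fin K → ZMod p)) ≤ 3 * M := by
      calc _ ≤ ∑ x ∈ X, (3:ℝ) := Finset.sum_le_sum fun x _ => (DD_bounds p _).2
        _ = _ := by simp [hXM]; ring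
    have hc := h.cube
    calc _ ≤ (p:ℝ)^K * (((Fintype.card V : ℝ) * (1 - 3/N) + 3 * B) + 3 * M) := by gcongr
      _ = _ := by ring
  · have hb := h.bad
    rw [Nat.card_eq_fintype_card, Fintype.card_subtype] at hb ⊢
    have hsub : (Finset.univ.filter (fun z : V × (Fin K → ZMod p) => F z.1 z.2 ≠ 1)) ⊆
        ((Finset.univ.filter (fun x => φ x ≠ 1)) ∪ X) ×ˢ Finset.univ := by
      rintro ⟨x, y⟩ hz
      simp only [Finset.mem_filter, Finset.mem_univ, true_and, Finset.mem_product, Finset.mem_union,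
        and_true] at hz ⊢
      by_contra hcon
      push Not at hcon
      apply hz
      simp [F, Γ, hcon.1, hcon.2]
    have hle := Finset.card_le_card hsub
    rw [Finset.card_product] at hle
    have hu := Finset.card_union_le (Finset.univ.filter (fun x => φ x ≠ 1)) X
    rw [hXM] at hu
    have hcW : ((Finset.univ : Finset (Fin K → ZMod p)).card : ℝ) = (p:ℝ)^K := by
      simp [ZMod.card]
    calc _ ≤ (((((Finset.univ.filter (fun x => φ x ≠ 1)) ∪ X).card *
          (Finset.univ : Finset (Fin K → ZMod p)).card : ℕ)) : ℝ) := by exact_mod_cast hle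
      _ ≤ (((Finset.univ.filter (fun x => φ x ≠ 1)).card + M : ℕ) : ℝ) * (p:ℝ)^K := by
          rw [Nat.cast_mul, hcW]
          gcongr
      _ ≤ _ := by
          push_cast
          gcongr

lemma htwo_pi (p : ℕ) [Fact p.Prime] (hodd : Odd p) {n : ℕ} (d : Fin n → ZMod p)
    (h : 2 • d = 0) : d = 0 := by
  funext i
  have := congrFun h i
  simp only [Pi.smul_apply, Pi.zero_apply, nsmul_eq_mul, Nat.cast_ofNat] at this
  exact (mul_eq_zero.1 this).resolve_left (two_ne p hodd)

/-- splitting coordinates -/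
def splitEquiv (R : Type) [AddCommGroup R] (n K : ℕ) :
    (Fin (n + K) → R) ≃+ (Fin n → R) × (Fin K → R) where
  toFun z := ((Fin.appendEquiv n K).symm z)
  invFun z := Fin.appendEquiv n K z
  left_inv z := (Fin.appendEquiv n K).apply_symm_apply z
  right_inv z := (Fin.appendEquiv n K).symm_apply_apply z
  map_add' x y := rfl

lemma Good.base (p : ℕ) [Fact p.Prime] (hodd : Odd p) (n : ℕ) :
    ∃ φ : (Fin n → ZMod p) → ℝ, Good (Fin n → ZMod p) ((p:ℝ)^n) 1 φ := by
  classical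
  have hp : (0:ℝ) < p := by exact_mod_cast (Fact.out : p.Prime).pos
  have cV : (Fintype.card (Fin n → ZMod p) : ℝ) = (p:ℝ)^n := by simp [ZMod.card]
  have hpn : (p:ℝ)^n ≠ 0 := by positivity
  have s1 : ∑ x : Fin n → ZMod p, (1:ℝ) = (p:ℝ)^n := by simp [ZMod.card]
  have sd : ∀ a : Fin n → ZMod p, ∑ x, (if x = a then (1:ℝ) else 0) = 1 := by
    intro a; simp
  refine ⟨fun x => 1 - if x = 0 then 1 else 0, ?_, ?_, ?_, ?_, ?_, ?_⟩
  · intro x; split_ifs <;> norm_num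
  · intro x; split_ifs <;> norm_num
  · rw [cV, Finset.sum_sub_distrib, s1, sd]; field_simp
  · intro d hd
    have hd2 : 2 • d ≠ 0 := fun h => hd (htwo_pi p hodd d h)
    have : ∀ x : Fin n → ZMod p, (1 - if x = 0 then (1:ℝ) else 0) * (1 - if x + d = 0 then (1:ℝ) else 0) *
        (1 - if x + 2 • d = 0 then (1:ℝ) else 0) ≤
        1 - (if x = 0 then (1:ℝ) else 0) - (if x = -d then (1:ℝ) else 0) -
          (if x = -(2 • d) then (1:ℝ) else 0) := by
      intro x
      simp only [← eq_neg_iff_add_eq_zero]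
      by_cases a : x = 0
      · have b : x ≠ -d := by
          subst a; intro h; exact hd (neg_eq_zero.1 h.symm)
        have c : x ≠ -(2 • d) := by
          subst a; intro h; exact hd2 (neg_eq_zero.1 h.symm)
        simp only [if_pos a, if_neg b, if_neg c]; norm_num
      · by_cases b : x = -d
        · have c : x ≠ -(2 • d) := by
            subst b; intro h; rw [neg_inj, two_nsmul] at h
            exact hd (by simpa using h)
          simp only [if_neg a, if_pos b, if_neg c]; norm_num
        · simp only [if_neg a, if_neg b]; split_ifs <;> norm_num
    refine le_trans (Finset.sum_le_sum fun x _ => this x) ?_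
    rw [cV]
    simp only [Finset.sum_sub_distrib, s1, sd]
    apply le_of_eq; field_simp; ring
  · have : ∀ x : Fin n → ZMod p, (1 - if x = 0 then (1:ℝ) else 0) * (1 - if x = 0 then (1:ℝ) else 0) *
        (1 - if x = 0 then (1:ℝ) else 0) = 1 - (if x = 0 then (1:ℝ) else 0) := by
      intro x; split_ifs <;> norm_num
    simp only [this]
    rw [cV, Finset.sum_sub_distrib, s1, sd]
    have : (p:ℝ)^n * (1 - 3 / (p:ℝ)^n) = (p:ℝ)^n - 3 := by field_simp
    rw [this]; linarith
  · rw [Nat.card_eq_fintype_card, Fintype.card_subtype]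
    have : (Finset.univ.filter (fun x : Fin n → ZMod p => (1 - if x = 0 then (1:ℝ) else 0) ≠ 1)) ⊆ {0} := by
      intro x hx
      simp only [Finset.mem_filter, Finset.mem_univ, true_and] at hx
      by_contra h
      simp only [Finset.mem_singleton] at h
      simp [h] at hx
    exact_mod_cast Finset.card_le_card this

lemma num1 (p K : ℕ) (hp : 3 ≤ p) (hK : 64 ≤ K) :
    (p:ℝ)^K * Real.exp (-((2^20 * p * K : ℕ) : ℝ) / 589824) ≤ 1/4 := by
  have hpr : (3:ℝ) ≤ p := by exact_mod_cast hp
  have hKr : (64:ℝ) ≤ K := by exact_mod_cast hK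
  have h1 : (p:ℝ) ≤ Real.exp ((p:ℝ) - 1) := by
    have := Real.add_one_le_exp ((p:ℝ) - 1); linarith
  have h2 : (p:ℝ)^K ≤ Real.exp (K * ((p:ℝ) - 1)) := by
    rw [Real.exp_nat_mul]; gcongr
  calc _ ≤ Real.exp (K * ((p:ℝ) - 1)) * Real.exp (-((2^20 * p * K : ℕ) : ℝ) / 589824) := by gcongr
    _ = Real.exp (K * ((p:ℝ) - 1) + (-((2^20 * p * K : ℕ) : ℝ) / 589824)) := by rw [Real.exp_add]
    _ ≤ Real.exp (-3) := by
      apply Real.exp_le_exp.2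
      push_cast
      nlinarith
    _ ≤ 1/4 := by
      rw [Real.exp_neg, inv_le_comm₀ (Real.exp_pos _) (by norm_num)]
      have := Real.add_one_le_exp (3:ℝ)
      norm_num at this ⊢; linarith

lemma num2 (p K : ℕ) (hp : 3 ≤ p) (hK : 64 ≤ K) :
    ((2^20 * p * K : ℕ) : ℝ)^3 * (p:ℝ)^2 ≤ 1/4 * (p:ℝ)^K := by
  obtain ⟨j, rfl⟩ := Nat.exists_eq_add_of_le hK
  have h1 : ∀ j : ℕ, 2^62 * (64 + j)^3 ≤ 3^(59 + j) := by
    intro j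
    induction j with
    | zero => norm_num
    | succ j ih =>
      have : 3^(59 + (j+1)) = 3 * 3^(59+j) := by ring
      rw [this]
      nlinarith [Nat.zero_le j, Nat.zero_le (j^2), Nat.zero_le (j^3)]
  have h2 : 2^62 * (64 + j)^3 ≤ p^(59 + j) := (h1 j).trans (Nat.pow_le_pow_left hp _)
  have h3 : 4 * ((2^20 * p * (64 + j))^3 * p^2) ≤ p^(64 + j) := by
    calc 4 * ((2^20 * p * (64 + j))^3 * p^2) = (2^62 * (64 + j)^3) * p^5 := by ring
      _ ≤ p^(59+j) * p^5 := by gcongr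
      _ = _ := by ring
  have h4 : (4:ℝ) * (((2^20 * p * (64 + j) : ℕ):ℝ)^3 * (p:ℝ)^2) ≤ (p:ℝ)^(64 + j) := by
    exact_mod_cast h3
  calc _ = 1/4 * ((4:ℝ) * (((2^20 * p * (64 + j) : ℕ):ℝ)^3 * (p:ℝ)^2)) := by ring
    _ ≤ _ := by gcongr

lemma Good.iter (p : ℕ) [Fact p.Prime] (hodd : Odd p) (n0 h : ℕ)
    (hn0 : 2^(10 * h + 27) * p ≤ p^n0) :
    ∀ i, i ≤ h + 1 → ∃ (n K : ℕ) (B : ℝ), (∃ φ : (Fin n → ZMod p) → ℝ,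
      Good (Fin n → ZMod p) ((p:ℝ)^n0) B φ) ∧ 64 ≤ K ∧ towerP p i ≤ K ∧
      384 * B ≤ ((2^20 * p * K : ℕ) : ℝ) ∧ (2^20 * p * K) * p^n0 ≤ 2^(10 * i + 26) * p * p^n ∧
      (∀ i', i = i' + 1 → towerP p i' ≤ n) := by
  have hp3 : 3 ≤ p := by
    have := (Fact.out : p.Prime).two_le
    rcases hodd with ⟨k, rfl⟩; omega
  have hpr : (3:ℝ) ≤ p := by exact_mod_cast hp3
  intro i
  induction i with
  | zero =>
    intro _
    refine ⟨n0, 64, 1, Good.base p hodd n0, le_rfl, by simp [towerP], ?_, ?_, by simp⟩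
    · push_cast; linarith
    · apply le_of_eq; ring
  | succ i ih =>
    intro hi
    obtain ⟨n, K, B, ⟨φ, hφ⟩, hK, hT, hB, hs, -⟩ := ih (by omega)
    set M := 2^20 * p * K with hM
    have hMn : 2 * M ≤ p^n := by
      have h1 : 2^(10 * i + 27) * p ≤ p^n0 :=
        le_trans (by gcongr; · norm_num
                     · omega) hn0
      have h2 : (2 * M) * p^n0 ≤ p^n * p^n0 := by
        calc (2 * M) * p^n0 = 2 * (M * p^n0) := by ring
          _ ≤ 2 * (2^(10 * i + 26) * p * p^n) := by gcongr
          _ = (2^(10 * i + 27) * p) * p^n := by ring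
          _ ≤ p^n0 * p^n := by gcongr
          _ = _ := by ring
      exact Nat.le_of_mul_le_mul_right h2 (by positivity)
    have hMr : 2 * (M:ℝ) ≤ (p:ℝ)^n := by exact_mod_cast hMn
    have cV : (Fintype.card (Fin n → ZMod p) : ℝ) = (p:ℝ)^n := by simp [ZMod.card]
    have hM0 : (0:ℝ) ≤ M := by positivity
    have hM2 : 2 ≤ M := by rw [hM]; nlinarith
    obtain ⟨Φ, hΦ⟩ := hφ.step p hodd (htwo_pi p hodd) K M hM2 (num1 p K hp3 hK) (num2 p K hp3 hK)
      hB (by rw [cV]; linarith)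
    have hpK : 1 ≤ p^K := Nat.one_le_pow _ _ (by omega)
    refine ⟨n + K, 2^10 * K * p^K, (B + M) * (p:ℝ)^K, ⟨_, hΦ.transport (splitEquiv (ZMod p) n K)⟩,
      ?_, ?_, ?_, ?_, ?_⟩
    · nlinarith
    · calc towerP p (i+1) = p^(towerP p i) := rfl
        _ ≤ p^K := Nat.pow_le_pow_right (by omega) hT
        _ ≤ _ := by nlinarith
    · have e : ((2^20 * p * (2^10 * K * p^K) : ℕ) : ℝ) = 1024 * (M:ℝ) * (p:ℝ)^K := by
        rw [hM]; push_cast; ring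
      rw [e, ← mul_assoc]
      exact mul_le_mul_of_nonneg_right (by linarith) (by positivity)
    · calc (2^20 * p * (2^10 * K * p^K)) * p^n0 = 2^10 * p^K * (M * p^n0) := by rw [hM]; ring
        _ ≤ 2^10 * p^K * (2^(10 * i + 26) * p * p^n) := by gcongr
        _ = _ := by ring
    · intro i' hi'
      obtain rfl : i = i' := by omega
      omega

/-- Weighted lower bound. Let `p` be an odd prime, `0 < α ≤ 1/2`,
and `0 < ε ≤ 2⁻¹⁶⁰ p⁻⁸`. Then there exists `n` at least an exponential tower of `p`'s
of height `(1/52) log₂(2/ε)` and a function `f : 𝔽_p^n → [0,1]` of density `α` such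
that for every nonzero `d ∈ 𝔽_p^n`, the density of 3-APs with common difference `d`
of `f` is less than `(1 - ε) α³`. -/
theorem lower_bound_weighted (p : ℕ) [Fact p.Prime] (hodd : Odd p) (α ε : ℝ)
    (hα0 : 0 < α) (hα : α ≤ 1 / 2) (hε0 : 0 < ε)
    (hε : ε ≤ (2 : ℝ) ^ (-160 : ℤ) * (p : ℝ) ^ (-8 : ℤ)) :
    ∃ n : ℕ, towerP p ⌊(1 / 52 : ℝ) * Real.logb 2 (2 / ε)⌋₊ ≤ n ∧
      ∃ f : (Fin n → ZMod p) → ℝ, (∀ x, f x ∈ Set.Icc (0 : ℝ) 1) ∧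
        (∑ x, f x) / (p : ℝ) ^ n = α ∧
        ∀ d : Fin n → ZMod p, d ≠ 0 →
          (∑ x, f x * f (x + d) * f (x + 2 • d)) / (p : ℝ) ^ n < (1 - ε) * α ^ 3 := by
  have hp3 : 3 ≤ p := by
    have := (Fact.out : p.Prime).two_le
    rcases hodd with ⟨k, rfl⟩; omega
  have hpr : (3:ℝ) ≤ p := by exact_mod_cast hp3
  have hp0 : (0:ℝ) < p := by linarith
  set h := ⌊(1 / 52 : ℝ) * Real.logb 2 (2 / ε)⌋₊ with hh
  -- the two bounds on ε
  have hE1 : (2:ℝ)^160 * (p:ℝ)^8 * ε ≤ 1 := by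
    have : (2 : ℝ) ^ (-160 : ℤ) * (p : ℝ) ^ (-8 : ℤ) = 1 / ((2:ℝ)^160 * (p:ℝ)^8) := by
      rw [zpow_neg, zpow_neg, one_div, mul_inv]; rfl
    rw [this, le_div_iff₀ (by positivity)] at hε
    linarith
  have hE2 : (2:ℝ)^(52 * h) * ε ≤ 2 := by
    have hε1 : ε ≤ 1 := by
      refine le_trans ?_ hE1
      have h1 : (1:ℝ) ≤ (2:ℝ)^160 * (p:ℝ)^8 := by
        have := one_le_pow₀ (M₀ := ℝ) (a := 2) (n := 160) (by norm_num)
        have := one_le_pow₀ (M₀ := ℝ) (a := p) (n := 8) (by linarith)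
        nlinarith
      nlinarith
    have hl0 : 0 ≤ (1 / 52 : ℝ) * Real.logb 2 (2 / ε) := by
      apply mul_nonneg (by norm_num)
      apply Real.logb_nonneg (by norm_num)
      rw [le_div_iff₀ hε0]; linarith
    have hf : (h:ℝ) ≤ (1 / 52 : ℝ) * Real.logb 2 (2 / ε) := Nat.floor_le hl0
    have hf2 : ((52 * h : ℕ):ℝ) ≤ Real.logb 2 (2 / ε) := by push_cast; linarith
    rw [Real.le_logb_iff_rpow_le (by norm_num) (by positivity), Real.rpow_natCast,
      le_div_iff₀ hε0] at hf2
    exact hf2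
  -- choice of n0
  obtain ⟨n0, hn1, hn2⟩ : ∃ n0, 2^(10 * h + 27) * p ≤ p^n0 ∧ p^n0 ≤ 2^(10 * h + 27) * p * p := by
    have hex : ∃ m, 2^(10 * h + 27) * p ≤ p^m :=
      ⟨_, (Nat.lt_pow_self (by omega : 1 < p)).le⟩
    classical
    refine ⟨Nat.find hex, Nat.find_spec hex, ?_⟩
    rcases hm : Nat.find hex with _ | m
    · exact Nat.one_le_iff_ne_zero.2 (by positivity)
    · have := Nat.find_min hex (m := m) (by omega)
      push Not at this
      rw [pow_succ]
      exact Nat.mul_le_mul_right _ this.le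
  set N : ℝ := (p:ℝ)^n0 with hN
  have hN1 : (2:ℝ)^(10 * h + 27) * p ≤ N := by rw [hN]; exact_mod_cast hn1
  have hN2 : N ≤ (2:ℝ)^(10 * h + 27) * p * p := by rw [hN]; exact_mod_cast hn2
  have hN5 : 5 ≤ N := by
    have : (2:ℝ)^27 ≤ (2:ℝ)^(10 * h + 27) := pow_le_pow_right₀ (by norm_num) (by omega)
    have h27 : (2:ℝ)^27 = 134217728 := by norm_num
    nlinarith
  have hNε : ε * N^2 ≤ 1 := by
    have h1 : N^2 ≤ (2:ℝ)^(20 * h + 54) * (p:ℝ)^4 := by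
      calc N^2 ≤ ((2:ℝ)^(10 * h + 27) * p * p)^2 := by gcongr
        _ = _ := by ring
    have h2 : (ε * N^2)^2 ≤ 1 := by
      calc (ε * N^2)^2 ≤ (ε * ((2:ℝ)^(20 * h + 54) * (p:ℝ)^4))^2 := by gcongr
        _ = ((2:ℝ)^(40 * h) * ε) * ((2:ℝ)^108 * (p:ℝ)^8 * ε) := by ring
        _ ≤ 2 * (1 / 2^52) := by
          have e1 : (2:ℝ)^(40 * h) * ε ≤ 2 := by
            refine le_trans ?_ hE2
            gcongr
            · norm_num
            · norm_num
          have e2 : (2:ℝ)^108 * (p:ℝ)^8 * ε ≤ 1 / 2^52 := by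
            rw [le_div_iff₀ (by positivity)]
            calc _ = (2:ℝ)^160 * (p:ℝ)^8 * ε := by ring
              _ ≤ 1 := hE1
          gcongr
        _ ≤ 1 := by norm_num
    exact (sq_le_one_iff₀ (by positivity)).1 h2
  obtain ⟨n, K, B, ⟨φ, hφ⟩, -, -, -, -, hT⟩ := Good.iter p hodd n0 h hn1 (h+1) le_rfl
  rw [← hN] at hφ
  have cV : (Fintype.card (Fin n → ZMod p) : ℝ) = (p:ℝ)^n := by simp [ZMod.card]
  have hpn : (0:ℝ) < (p:ℝ)^n := by positivity
  have hN1' : 0 < N - 1 := by linarith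
  set c : ℝ := N / (N - 1) with hc
  have hc0 : 0 < c := by positivity
  have hc1 : c ≤ 5/4 := by rw [hc, div_le_iff₀ hN1']; linarith
  refine ⟨n, hT h rfl, fun x => α * c * φ x, ?_, ?_, ?_⟩
  · intro x
    refine ⟨mul_nonneg (by positivity) (hφ.nonneg x), ?_⟩
    calc α * c * φ x ≤ (1/2) * (5/4) * (25/16) := by
          have := hφ.nonneg x
          have := hφ.le x
          gcongr
      _ ≤ 1 := by norm_num
  · rw [← Finset.mul_sum, hφ.mean, cV, hc]
    field_simp
  · intro d hd
    have e : ∑ x, α * c * φ x * (α * c * φ (x + d)) * (α * c * φ (x + 2 • d)) =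
        (α * c)^3 * ∑ x, φ x * φ (x + d) * φ (x + 2 • d) := by
      rw [Finset.mul_sum]; apply Finset.sum_congr rfl; intro x _; ring
    rw [e, div_lt_iff₀ hpn]
    have hap := hφ.ap d hd
    rw [cV] at hap
    have key : c^3 * (1 - 3/N) < 1 - ε := by
      have e2 : c^3 * (1 - 3/N) = N^2 * (N - 3) / (N-1)^3 := by
        rw [hc]; field_simp
      rw [e2, div_lt_iff₀ (by positivity)]
      have hεN : ε * (N-1)^3 ≤ N := by
        have h1 : (N-1)^3 ≤ N^3 := by gcongr; linarith
        calc ε * (N-1)^3 ≤ ε * N^3 := by gcongr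
          _ = (ε * N^2) * N := by ring
          _ ≤ 1 * N := by gcongr
          _ = N := one_mul _
      nlinarith
    calc _ ≤ (α * c)^3 * ((p:ℝ)^n * (1 - 3/N)) := by gcongr
      _ = α^3 * (p:ℝ)^n * (c^3 * (1 - 3/N)) := by ring
      _ < α^3 * (p:ℝ)^n * (1 - ε) := by gcongr
      _ = _ := by ring
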